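/- Two CCω terms are convertible exactly when they have a common reduct: t ≡ u if and only if there exists a term w such that t ↠ w and u ↠ w. -/

import Mathlib

/-! Formalization of CCω (terms, reduction, conversion, undirected and
bidirectional typing, cumulativity) using de Bruijn indices, following
Lennon-Bertrand, "Complete Bidirectional Typing for the Calculus of
Inductive Constructions". -/

namespace CComega

/-- Terms of CCω: `t ::= x | □_i | Πx:t.t | λx:t.t | t t`,
with variables as de Bruijn indices. -/
inductive Tm : Type
  | var : ℕ → Tm
  | sort : ℕ → Tm
  | pi : Tm → Tm → Tm
  | lam : Tm → Tm → Tm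
  | app : Tm → Tm → Tm
deriving DecidableEq

/-- `lift n k t` shifts by `n` the de Bruijn indices of `t` that are ≥ `k`. -/
def lift (n k : ℕ) : Tm → Tm
  | .var i => if i < k then .var i else .var (i + n)
  | .sort i => .sort i
  | .pi A B => .pi (lift n k A) (lift n (k + 1) B)
  | .lam A t => .lam (lift n k A) (lift n (k + 1) t)
  | .app t u => .app (lift n k t) (lift n k u)

/-- `subst u k t` is the capture-avoiding substitution `t[u/k]` of `u`
for de Bruijn index `k` in `t`. -/
def subst (u : Tm) (k : ℕ) : Tm → Tm
  | .var i => if i < k then .var i else if i = k then lift k 0 u else .var (i - 1)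
  | .sort i => .sort i
  | .pi A B => .pi (subst u k A) (subst u (k + 1) B)
  | .lam A t => .lam (subst u k A) (subst u (k + 1) t)
  | .app t v => .app (subst u k t) (subst u k v)

/-- One-step reduction `t → t'`: the least congruence such that
`(λx:A.t) u → t[u/x]`. -/
inductive Red : Tm → Tm → Prop
  | beta (A t u : Tm) : Red (.app (.lam A t) u) (subst u 0 t)
  | piDom {A A'} (B : Tm) : Red A A' → Red (.pi A B) (.pi A' B)
  | piCod (A : Tm) {B B'} : Red B B' → Red (.pi A B) (.pi A B')
  | lamDom {A A'} (t : Tm) : Red A A' → Red (.lam A t) (.lam A' t)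
  | lamBody (A : Tm) {t t'} : Red t t' → Red (.lam A t) (.lam A t')
  | appFun {t t'} (u : Tm) : Red t t' → Red (.app t u) (.app t' u)
  | appArg (t : Tm) {u u'} : Red u u' → Red (.app t u) (.app t u')

/-- Multi-step reduction `t ↠ t'`: reflexive-transitive closure of `→`. -/
def Reds : Tm → Tm → Prop := Relation.ReflTransGen Red

/-- Conversion `t ≡ u`: symmetric, reflexive, transitive closure of `→`. -/
def Conv : Tm → Tm → Prop := Relation.EqvGen Red

/-- Contexts are lists of (de Bruijn) declarations, most recent first. -/
abbrev Ctx := List Tm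

mutual
/-- Context well-formedness `⊢ Γ`. -/
inductive WfCtx : Ctx → Prop
  | nil : WfCtx []
  | cons {Γ A i} : WfCtx Γ → Typed Γ A (.sort i) → WfCtx (A :: Γ)

/-- Undirected typing `Γ ⊢ t : T`. -/
inductive Typed : Ctx → Tm → Tm → Prop
  | sort {Γ i} : WfCtx Γ → Typed Γ (.sort i) (.sort (i + 1))
  | var {Γ n A} : WfCtx Γ → Γ[n]? = some A → Typed Γ (.var n) (lift (n + 1) 0 A)
  | pi {Γ A B i j} : Typed Γ A (.sort i) → Typed (A :: Γ) B (.sort j) →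
      Typed Γ (.pi A B) (.sort (max i j))
  | lam {Γ A B t i} : Typed Γ (.pi A B) (.sort i) → Typed (A :: Γ) t B →
      Typed Γ (.lam A t) (.pi A B)
  | app {Γ t u A B} : Typed Γ t (.pi A B) → Typed Γ u A →
      Typed Γ (.app t u) (subst u 0 B)
  | conv {Γ t A B i} : Typed Γ t A → Typed Γ B (.sort i) → Conv A B →
      Typed Γ t B
end

mutual
/-- Bidirectional inference `Γ ⊢ t ▹ T`. -/
inductive Infer : Ctx → Tm → Tm → Prop
  | sort {Γ i} : Infer Γ (.sort i) (.sort (i + 1))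
  | var {Γ n A} : Γ[n]? = some A → Infer Γ (.var n) (lift (n + 1) 0 A)
  | pi {Γ A B i j} : InferSort Γ A (.sort i) → InferSort (A :: Γ) B (.sort j) →
      Infer Γ (.pi A B) (.sort (max i j))
  | lam {Γ A t B i} : InferSort Γ A (.sort i) → Infer (A :: Γ) t B →
      Infer Γ (.lam A t) (.pi A B)
  | app {Γ t u A B} : InferPi Γ t (.pi A B) → Check Γ u A →
      Infer Γ (.app t u) (subst u 0 B)

/-- Bidirectional checking `Γ ⊢ t ◃ T`. -/
inductive Check : Ctx → Tm → Tm → Prop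
  | check {Γ t T T'} : Infer Γ t T' → Conv T' T → Check Γ t T

/-- Constrained inference `Γ ⊢ t ▹_□ T` (the output is a universe). -/
inductive InferSort : Ctx → Tm → Tm → Prop
  | inferSort {Γ t T i} : Infer Γ t T → Reds T (.sort i) → InferSort Γ t (.sort i)

/-- Constrained inference `Γ ⊢ t ▹_Π T` (the output is a product type). -/
inductive InferPi : Ctx → Tm → Tm → Prop
  | inferPi {Γ t T A B} : Infer Γ t T → Reds T (.pi A B) → InferPi Γ t (.pi A B)
end

/-- Weak-head reduction `t ⇝ t'`: reduction only at the head. -/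
inductive WhRed : Tm → Tm → Prop
  | beta (A t u : Tm) : WhRed (.app (.lam A t) u) (subst u 0 t)
  | appFun {t t'} (u : Tm) : WhRed t t' → WhRed (.app t u) (.app t' u)

/-- Multi-step weak-head reduction `t ⇝* t'`. -/
def WhReds : Tm → Tm → Prop := Relation.ReflTransGen WhRed

mutual
/-- Weak-head bidirectional inference: as `Infer`, but constrained inference
uses weak-head reduction. -/
inductive InferW : Ctx → Tm → Tm → Prop
  | sort {Γ i} : InferW Γ (.sort i) (.sort (i + 1))
  | var {Γ n A} : Γ[n]? = some A → InferW Γ (.var n) (lift (n + 1) 0 A)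
  | pi {Γ A B i j} : InferSortW Γ A (.sort i) → InferSortW (A :: Γ) B (.sort j) →
      InferW Γ (.pi A B) (.sort (max i j))
  | lam {Γ A t B i} : InferSortW Γ A (.sort i) → InferW (A :: Γ) t B →
      InferW Γ (.lam A t) (.pi A B)
  | app {Γ t u A B} : InferPiW Γ t (.pi A B) → CheckW Γ u A →
      InferW Γ (.app t u) (subst u 0 B)

/-- Weak-head bidirectional checking. -/
inductive CheckW : Ctx → Tm → Tm → Prop
  | check {Γ t T T'} : InferW Γ t T' → Conv T' T → CheckW Γ t T

/-- Weak-head constrained inference `Γ ⊢ t ▹_□ T`. -/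
inductive InferSortW : Ctx → Tm → Tm → Prop
  | inferSort {Γ t T i} : InferW Γ t T → WhReds T (.sort i) →
      InferSortW Γ t (.sort i)

/-- Weak-head constrained inference `Γ ⊢ t ▹_Π T`. -/
inductive InferPiW : Ctx → Tm → Tm → Prop
  | inferPi {Γ t T A B} : InferW Γ t T → WhReds T (.pi A B) →
      InferPiW Γ t (.pi A B)
end

/-- Cumulativity `t ≼ u`: the least transitive relation containing conversion
such that `□_i ≼ □_j` whenever `i ≤ j` and `Πx:A.B ≼ Πx:A'.B'` whenever
`A ≡ A'` and `B ≼ B'`. -/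
inductive Cum : Tm → Tm → Prop
  | ofConv {t u} : Conv t u → Cum t u
  | sort {i j : ℕ} : i ≤ j → Cum (.sort i) (.sort j)
  | pi {A A' B B'} : Conv A A' → Cum B B' → Cum (.pi A B) (.pi A' B')
  | trans {t u v} : Cum t u → Cum u v → Cum t v

mutual
/-- Context well-formedness for the cumulative undirected system. -/
inductive WfCtxC : Ctx → Prop
  | nil : WfCtxC []
  | cons {Γ A i} : WfCtxC Γ → TypedC Γ A (.sort i) → WfCtxC (A :: Γ)

/-- Cumulative undirected typing `Γ ⊢ t : T`: as `Typed`, with the conversion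
rule replaced by cumulativity. -/
inductive TypedC : Ctx → Tm → Tm → Prop
  | sort {Γ i} : WfCtxC Γ → TypedC Γ (.sort i) (.sort (i + 1))
  | var {Γ n A} : WfCtxC Γ → Γ[n]? = some A → TypedC Γ (.var n) (lift (n + 1) 0 A)
  | pi {Γ A B i j} : TypedC Γ A (.sort i) → TypedC (A :: Γ) B (.sort j) →
      TypedC Γ (.pi A B) (.sort (max i j))
  | lam {Γ A B t i} : TypedC Γ (.pi A B) (.sort i) → TypedC (A :: Γ) t B →
      TypedC Γ (.lam A t) (.pi A B)
  | app {Γ t u A B} : TypedC Γ t (.pi A B) → TypedC Γ u A →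
      TypedC Γ (.app t u) (subst u 0 B)
  | cumul {Γ t A B i} : TypedC Γ t A → TypedC Γ B (.sort i) → Cum A B →
      TypedC Γ t B
end

mutual
/-- Cumulative bidirectional inference `Γ ⊢ t ▹ T`. -/
inductive InferC : Ctx → Tm → Tm → Prop
  | sort {Γ i} : InferC Γ (.sort i) (.sort (i + 1))
  | var {Γ n A} : Γ[n]? = some A → InferC Γ (.var n) (lift (n + 1) 0 A)
  | pi {Γ A B i j} : InferSortC Γ A (.sort i) → InferSortC (A :: Γ) B (.sort j) →
      InferC Γ (.pi A B) (.sort (max i j))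
  | lam {Γ A t B i} : InferSortC Γ A (.sort i) → InferC (A :: Γ) t B →
      InferC Γ (.lam A t) (.pi A B)
  | app {Γ t u A B} : InferPiC Γ t (.pi A B) → CheckC Γ u A →
      InferC Γ (.app t u) (subst u 0 B)

/-- Cumulative bidirectional checking `Γ ⊢ t ◃ T`, using cumulativity. -/
inductive CheckC : Ctx → Tm → Tm → Prop
  | check {Γ t T T'} : InferC Γ t T' → Cum T' T → CheckC Γ t T

/-- Cumulative constrained inference `Γ ⊢ t ▹_□ T` (unchanged: uses reduction). -/
inductive InferSortC : Ctx → Tm → Tm → Prop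
  | inferSort {Γ t T i} : InferC Γ t T → Reds T (.sort i) → InferSortC Γ t (.sort i)

/-- Cumulative constrained inference `Γ ⊢ t ▹_Π T` (unchanged: uses reduction). -/
inductive InferPiC : Ctx → Tm → Tm → Prop
  | inferPi {Γ t T A B} : InferC Γ t T → Reds T (.pi A B) → InferPiC Γ t (.pi A B)
end

/-! ### Commutation of lifting and substitution -/

theorem lift_zero (t : Tm) (k : ℕ) : lift 0 k t = t := by
  induction t generalizing k <;> simp_all [lift]

theorem lift_lift_of_le (t : Tm) {m n j k : ℕ} (h₁ : k ≤ j) (h₂ : j ≤ k + n) :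
    lift m j (lift n k t) = lift (m + n) k t := by
  induction t generalizing j k with
  | var i => grind [lift]
  | sort i => rfl
  | pi A B ihA ihB | lam A B ihA ihB =>
    simp only [lift]; rw [ihA h₁ h₂, ihB (by omega) (by omega)]
  | app t u iht ihu => simp only [lift]; rw [iht h₁ h₂, ihu h₁ h₂]

theorem lift_lift_comm (t : Tm) (m n : ℕ) {j k : ℕ} (h : j ≤ k) :
    lift n j (lift m k t) = lift m (k + n) (lift n j t) := by
  induction t generalizing j k with
  | var i => grind [lift]
  | sort i => rfl
  | pi A B ihA ihB | lam A B ihA ihB =>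
    simp only [lift]; rw [ihA h, ihB (by omega), Nat.add_right_comm]
  | app t u iht ihu => simp only [lift]; rw [iht h, ihu h]

theorem subst_lift_of_le (t u : Tm) {n j k : ℕ} (h₁ : k ≤ j) (h₂ : j ≤ k + n) :
    subst u j (lift (n + 1) k t) = lift n k t := by
  induction t generalizing j k with
  | var i => grind [lift, subst]
  | sort i => rfl
  | pi A B ihA ihB | lam A B ihA ihB =>
    simp only [lift, subst]; rw [ihA h₁ h₂, ihB (by omega) (by omega)]
  | app t u iht ihu => simp only [lift, subst]; rw [iht h₁ h₂, ihu h₁ h₂]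

theorem lift_subst (t u : Tm) (n j p : ℕ) :
    lift n (j + p) (subst u j t) = subst (lift n p u) j (lift n (j + p + 1) t) := by
  induction t generalizing j with
  | var i =>
    rcases lt_trichotomy i j with h | rfl | h
    · grind [lift, subst]
    · simp [lift, subst, lift_lift_comm u n i (Nat.zero_le p), Nat.add_comm]
    · grind [lift, subst]
  | sort i => rfl
  | pi A B ihA ihB | lam A B ihA ihB =>
    simp only [lift, subst]; rw [ihA, Nat.add_right_comm, ihB, Nat.add_right_comm j 1 p]
  | app t u iht ihu => simp only [lift, subst]; rw [iht, ihu]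

theorem subst_lift_comm (t u : Tm) (n : ℕ) {j k : ℕ} (h : k ≤ j) :
    subst u (j + n) (lift n k t) = lift n k (subst u j t) := by
  induction t generalizing j k with
  | var i =>
    rcases lt_trichotomy i j with h' | rfl | h'
    · grind [lift, subst]
    · simp [lift, subst, Nat.not_lt.2 h, Nat.add_comm,
        lift_lift_of_le u (m := n) (Nat.zero_le k) (by omega : k ≤ 0 + i)]
    · grind [lift, subst]
  | sort i => rfl
  | pi A B ihA ihB | lam A B ihA ihB =>
    simp only [lift, subst]; rw [ihA h, Nat.add_right_comm, ihB (by omega)]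
  | app t u iht ihu => simp only [lift, subst]; rw [iht h, ihu h]

theorem subst_subst (t u v : Tm) (j p : ℕ) :
    subst u (j + p) (subst v j t) = subst (subst u p v) j (subst u (j + p + 1) t) := by
  induction t generalizing j with
  | var i =>
    rcases lt_trichotomy i j with h | rfl | h
    · grind [subst]
    · have := subst_lift_comm v u i (Nat.zero_le p)
      simp [subst, Nat.add_comm p, show i < i + p + 1 by omega] at this ⊢
      exact this
    · rcases lt_trichotomy i (j + p + 1) with h' | rfl | h'
      · grind [subst]
      · simp [subst, show ¬ j + p + 1 < j by omega, show j + p + 1 ≠ j by omega,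
          subst_lift_of_le u _ (Nat.zero_le j) (by omega : j ≤ 0 + (j + p))]
      · grind [subst]
  | sort i => rfl
  | pi A B ihA ihB | lam A B ihA ihB =>
    simp only [subst]; rw [ihA, Nat.add_right_comm, ihB, Nat.add_right_comm j 1 p]
  | app t u iht ihu => simp only [subst]; rw [iht, ihu]

/-! ### Parallel reduction -/

/-- Parallel reduction: contracts any set of redexes of a term simultaneously. -/
inductive Par : Tm → Tm → Prop
  | var (i : ℕ) : Par (.var i) (.var i)
  | sort (i : ℕ) : Par (.sort i) (.sort i)
  | pi {A A' B B'} : Par A A' → Par B B' → Par (.pi A B) (.pi A' B')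
  | lam {A A' t t'} : Par A A' → Par t t' → Par (.lam A t) (.lam A' t')
  | app {t t' u u'} : Par t t' → Par u u' → Par (.app t u) (.app t' u')
  | beta (A) {t t' u u'} : Par t t' → Par u u' → Par (.app (.lam A t) u) (subst u' 0 t')

theorem Par.refl (t : Tm) : Par t t := by
  induction t <;> constructor <;> assumption

theorem Par.lift {t t' : Tm} (h : Par t t') (n k : ℕ) :
    Par (lift n k t) (lift n k t') := by
  induction h generalizing k with
  | var | sort => exact .refl _
  | pi _ _ ih₁ ih₂ => exact .pi (ih₁ _) (ih₂ _)
  | lam _ _ ih₁ ih₂ => exact .lam (ih₁ _) (ih₂ _)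
  | app _ _ ih₁ ih₂ => exact .app (ih₁ _) (ih₂ _)
  | @beta A t t' u u' _ _ ih₁ ih₂ =>
    have := lift_subst t' u' n 0 k
    rw [Nat.zero_add] at this
    rw [this]
    exact .beta _ (ih₁ _) (ih₂ _)

theorem Par.subst {t t' u u' : Tm} (h : Par t t') (hu : Par u u') (k : ℕ) :
    Par (subst u k t) (subst u' k t') := by
  induction h generalizing k with
  | var i =>
    simp only [CComega.subst]
    split_ifs
    · exact .refl _
    · exact hu.lift k 0
    · exact .refl _
  | sort => exact .refl _
  | pi _ _ ih₁ ih₂ => exact .pi (ih₁ _) (ih₂ _)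
  | lam _ _ ih₁ ih₂ => exact .lam (ih₁ _) (ih₂ _)
  | app _ _ ih₁ ih₂ => exact .app (ih₁ _) (ih₂ _)
  | @beta A t t' v v' _ _ ih₁ ih₂ =>
    have := subst_subst t' u' v' 0 k
    rw [Nat.zero_add] at this
    rw [this]
    exact .beta _ (ih₁ _) (ih₂ _)

/-- Complete development: contracts all the redexes of a term simultaneously. -/
def development : Tm → Tm
  | .var i => .var i
  | .sort i => .sort i
  | .pi A B => .pi (development A) (development B)
  | .lam A t => .lam (development A) (development t)
  | .app (.lam _ t) u => subst (development u) 0 (development t)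
  | .app t u => .app (development t) (development u)

/-- Every parallel reduct of a term reduces in parallel to its complete development. -/
theorem Par.development {t t' : Tm} (h : Par t t') : Par t' (development t) := by
  induction h with
  | var | sort => exact .refl _
  | pi _ _ ih₁ ih₂ => exact .pi ih₁ ih₂
  | lam _ _ ih₁ ih₂ => exact .lam ih₁ ih₂
  | beta A _ _ ih₁ ih₂ => exact ih₁.subst ih₂ 0
  | app h₁ _ ih₁ ih₂ =>
    cases h₁ with
    | lam => cases ih₁ with | lam _ ih => exact .beta _ ih ih₂
    | _ => exact .app ih₁ ih₂

/-! ### Confluence -/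

theorem Red.par {t t' : Tm} (h : Red t t') : Par t t' := by
  induction h with
  | beta A t u => exact .beta A (.refl t) (.refl u)
  | piDom B _ ih => exact .pi ih (.refl B)
  | piCod A _ ih => exact .pi (.refl A) ih
  | lamDom t _ ih => exact .lam ih (.refl t)
  | lamBody A _ ih => exact .lam (.refl A) ih
  | appFun u _ ih => exact .app ih (.refl u)
  | appArg t _ ih => exact .app (.refl t) ih

theorem Reds.pi {A A' B B' : Tm} (hA : Reds A A') (hB : Reds B B') :
    Reds (.pi A B) (.pi A' B') :=
  (hA.lift (Tm.pi · B) fun _ _ => .piDom B).trans (hB.lift (Tm.pi A') fun _ _ => .piCod A')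

theorem Reds.lam {A A' t t' : Tm} (hA : Reds A A') (ht : Reds t t') :
    Reds (.lam A t) (.lam A' t') :=
  (hA.lift (Tm.lam · t) fun _ _ => .lamDom t).trans (ht.lift (Tm.lam A') fun _ _ => .lamBody A')

theorem Reds.app {t t' u u' : Tm} (ht : Reds t t') (hu : Reds u u') :
    Reds (.app t u) (.app t' u') :=
  (ht.lift (Tm.app · u) fun _ _ => .appFun u).trans (hu.lift (Tm.app t') fun _ _ => .appArg t')

theorem Par.reds {t t' : Tm} (h : Par t t') : Reds t t' := by
  induction h with
  | var | sort => exact .refl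
  | pi _ _ ih₁ ih₂ => exact ih₁.pi ih₂
  | lam _ _ ih₁ ih₂ => exact ih₁.lam ih₂
  | app _ _ ih₁ ih₂ => exact ih₁.app ih₂
  | @beta A t t' u u' _ _ ih₁ ih₂ =>
    exact (Reds.app (Reds.lam .refl ih₁) ih₂).tail (.beta A t' u')

theorem reflTransGen_par_eq_reds : Relation.ReflTransGen Par = Reds :=
  le_antisymm (Relation.reflTransGen_closed fun _ _ => Par.reds)
    (Relation.ReflTransGen.mono fun _ _ => Red.par)

theorem equivalence_join_reds : Equivalence (Relation.Join Reds) := by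
  rw [← reflTransGen_par_eq_reds]
  exact Relation.equivalence_join_reflTransGen fun a _ _ hb hc =>
    ⟨development a, .single hb.development, .single hc.development⟩

theorem Reds.conv {t u : Tm} (h : Reds t u) : Conv t u := by
  induction h with
  | refl => exact .refl _
  | tail _ h ih => exact .trans _ _ _ ih (.rel _ _ h)

/-- **Conversion is joinability.** `t ≡ u` iff `t` and `u` have a common reduct. -/
theorem conv_iff_common_reduct {t u : Tm} :
    Conv t u ↔ ∃ w, Reds t w ∧ Reds u w := by
  constructor
  · intro h
    induction h with
    | rel _ u h => exact ⟨u, .single h, .refl⟩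
    | refl t => exact equivalence_join_reds.refl t
    | symm _ _ _ ih => exact equivalence_join_reds.symm ih
    | trans _ _ _ _ _ ih₁ ih₂ => exact equivalence_join_reds.trans ih₁ ih₂
  · rintro ⟨w, ht, hu⟩
    exact .trans _ _ _ ht.conv (.symm _ _ hu.conv)

end CComega
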